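/- For every integer n ≥ 3, the graph Δ_n = Cay(D_{3n}, {τ_0, τ_k, τ_n}), where k = 3/gcd(3, n), has girth exactly 6. -/

import Mathlib

/-- The Cayley graph of a group on a (symmetric) connection set `S`:
distinct `g, h` are adjacent iff `g * h⁻¹ ∈ S`. -/
def cayley {G : Type*} [Group G] (S : Set G) : SimpleGraph G :=
  SimpleGraph.fromRel (fun x y => x * y⁻¹ ∈ S)

/-- In the dihedral group `D_n = ⟨ρ, τ⟩`, the element `τ_i = ρ^i * τ`. -/
def dihTau {n : ℕ} (i : ℕ) : DihedralGroup n :=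
  (DihedralGroup.r 1) ^ i * DihedralGroup.sr 0

/-- The graph `Δ_n = Cay(D_{3n}, {τ_0, τ_k, τ_n})`, where `k = 3 / gcd(3, n)`. -/
def deltaGraph (n : ℕ) : SimpleGraph (DihedralGroup (3 * n)) :=
  cayley ({dihTau 0, dihTau (3 / Nat.gcd 3 n), dihTau n} : Set (DihedralGroup (3 * n)))

section DeltaGirth

variable {n : ℕ}

lemma dihTau_eq_sr (i : ℕ) : (dihTau i : DihedralGroup n) = .sr (-(i : ZMod n)) := by
  simp [dihTau]

/-- The connection set of `deltaGraph n`, read as a set of exponents of `ρ`. -/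
def deltaExponents (n : ℕ) : Set ℕ := {0, 3 / Nat.gcd 3 n, n}

lemma deltaGraph_adj_r_sr (i j : ZMod (3 * n)) :
    (deltaGraph n).Adj (.r i) (.sr j) ↔ ∃ t ∈ deltaExponents n, i = j + t := by
  have key (t : ℕ) : j - i = -(t : ZMod (3 * n)) ↔ i = j + t := by grind
  have key₀ : j - i = 0 ↔ i = j := by grind
  simp [deltaGraph, cayley, deltaExponents, dihTau_eq_sr, ← sub_eq_add_neg, key, key₀]

lemma deltaGraph_not_adj_r_r (i j : ZMod (3 * n)) : ¬ (deltaGraph n).Adj (.r i) (.r j) := by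
  simp [deltaGraph, cayley, dihTau_eq_sr]

lemma deltaGraph_not_adj_sr_sr (i j : ZMod (3 * n)) : ¬ (deltaGraph n).Adj (.sr i) (.sr j) := by
  simp [deltaGraph, cayley, dihTau_eq_sr]

/-- `deltaGraph n` is bipartite, with the rotations and the reflections as its parts. -/
def deltaColoring (n : ℕ) : (deltaGraph n).Coloring Bool :=
  SimpleGraph.Coloring.mk (fun | .r _ => true | .sr _ => false) <| by
    rintro (i | i) (j | j) h
    · exact absurd h (deltaGraph_not_adj_r_r i j)
    · simp
    · simp
    · exact absurd h (deltaGraph_not_adj_sr_sr i j)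

lemma three_div_gcd_bounds (hn : 3 ≤ n) :
    0 < 3 / Nat.gcd 3 n ∧ 3 / Nat.gcd 3 n < n ∧ 2 * (3 / Nat.gcd 3 n) ≠ n := by
  rcases (Nat.dvd_prime Nat.prime_three).1 (Nat.gcd_dvd_left 3 n) with h | h
  · have h3 : ¬ 3 ∣ n := fun hd => by simp [Nat.gcd_eq_left hd] at h
    rw [h]; omega
  · rw [h]; omega

lemma deltaExponents_le (hn : 3 ≤ n) {a : ℕ} (ha : a ∈ deltaExponents n) : a ≤ n := by
  have := three_div_gcd_bounds hn
  simp only [deltaExponents, Set.mem_insert_iff, Set.mem_singleton_iff] at ha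
  omega

lemma natCast_injOn_lt {m a b : ℕ} (ha : a < m) (hb : b < m) (h : (a : ZMod m) = b) : a = b :=
  Nat.ModEq.eq_of_lt_of_lt ((ZMod.natCast_eq_natCast_iff a b m).1 h) ha hb

/-- The exponents form a Sidon set modulo `3 * n`. -/
lemma deltaExponents_sidon (hn : 3 ≤ n) {a b c d : ℕ} (ha : a ∈ deltaExponents n)
    (hb : b ∈ deltaExponents n) (hc : c ∈ deltaExponents n) (hd : d ∈ deltaExponents n)
    (h : (a + c : ZMod (3 * n)) = b + d) : a = b ∨ a = d := by
  have hle := @deltaExponents_le n hn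
  have hac : a + c = b + d := by
    have := hle ha; have := hle hb; have := hle hc; have := hle hd
    exact natCast_injOn_lt (m := 3 * n) (by omega) (by omega) (by exact_mod_cast h)
  have := three_div_gcd_bounds hn
  simp only [deltaExponents, Set.mem_insert_iff, Set.mem_singleton_iff] at ha hb hc hd
  omega

lemma deltaGraph_r_sr_no_four_cycle (hn : 3 ≤ n) {i i' j j' : ZMod (3 * n)}
    (h₁ : (deltaGraph n).Adj (.r i) (.sr j)) (h₂ : (deltaGraph n).Adj (.r i') (.sr j))
    (h₃ : (deltaGraph n).Adj (.r i') (.sr j')) (h₄ : (deltaGraph n).Adj (.r i) (.sr j')) :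
    i = i' ∨ j = j' := by
  rw [deltaGraph_adj_r_sr] at h₁ h₂ h₃ h₄
  obtain ⟨a, ha, h₁⟩ := h₁
  obtain ⟨b, hb, h₂⟩ := h₂
  obtain ⟨c, hc, h₃⟩ := h₃
  obtain ⟨d, hd, h₄⟩ := h₄
  rcases deltaExponents_sidon hn ha hb hc hd (by grind) with rfl | rfl
  · exact .inl (h₁.trans h₂.symm)
  · exact .inr (by grind)

lemma deltaGraph_no_four_cycle (hn : 3 ≤ n) {x a y b : DihedralGroup (3 * n)}
    (h₁ : (deltaGraph n).Adj x a) (h₂ : (deltaGraph n).Adj a y)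
    (h₃ : (deltaGraph n).Adj y b) (h₄ : (deltaGraph n).Adj b x) : x = y ∨ a = b := by
  have hr := @deltaGraph_not_adj_r_r n
  have hs := @deltaGraph_not_adj_sr_sr n
  rcases x with i | i <;> rcases a with j | j <;> rcases y with i' | i' <;>
    rcases b with j' | j' <;> first
    | exact absurd h₁ (hr _ _) | exact absurd h₁ (hs _ _) | exact absurd h₂ (hr _ _)
    | exact absurd h₂ (hs _ _) | exact absurd h₃ (hr _ _) | exact absurd h₃ (hs _ _)
    | skip
  · rcases deltaGraph_r_sr_no_four_cycle hn h₁ h₂.symm h₃ h₄.symm with rfl | rfl <;> simp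
  · rcases deltaGraph_r_sr_no_four_cycle hn h₁.symm h₄ h₃.symm h₂ with rfl | rfl <;> simp

lemma six_le_length_of_isCycle (hn : 3 ≤ n) {x : DihedralGroup (3 * n)}
    (w : (deltaGraph n).Walk x x) (hw : w.IsCycle) : 6 ≤ w.length := by
  have heven : Even w.length := ((deltaColoring n).even_length_iff_congr w).2 Iff.rfl
  have h3 := hw.three_le_length
  by_contra! hlt
  have h4 : w.length = 4 := by obtain ⟨m, hm⟩ := heven; omega
  match w, h4 with
  | .cons h₁ (.cons h₂ (.cons h₃ (.cons h₄ .nil))), _ =>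
    have hnodup := hw.support_nodup
    rcases deltaGraph_no_four_cycle hn h₁ h₂ h₃ h₄ with rfl | rfl <;> simp at hnodup

lemma isCycle_of_nodup_six {V : Type*} {G : SimpleGraph V} {a b c d e f : V} (h₁ : G.Adj a b)
    (h₂ : G.Adj b c) (h₃ : G.Adj c d) (h₄ : G.Adj d e) (h₅ : G.Adj e f) (h₆ : G.Adj f a)
    (h : [a, b, c, d, e, f].Nodup) :
    (SimpleGraph.Walk.cons h₁
      (.cons h₂ (.cons h₃ (.cons h₄ (.cons h₅ (.cons h₆ .nil)))))).IsCycle := by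
  simp only [List.nodup_cons, List.mem_cons, List.not_mem_nil, List.nodup_nil] at h
  simp [SimpleGraph.Walk.cons_isCycle_iff, SimpleGraph.Walk.isPath_def]
  grind

lemma exists_isCycle_length_six (hn : 3 ≤ n) :
    ∃ (x : DihedralGroup (3 * n)) (w : (deltaGraph n).Walk x x), w.IsCycle ∧ w.length = 6 := by
  obtain ⟨hk, hkn, -⟩ := three_div_gcd_bounds hn
  have adj {t : ℕ} (ht : t ∈ deltaExponents n) {i j : ZMod (3 * n)} (h : i = j + t) :
      (deltaGraph n).Adj (.r i) (.sr j) := (deltaGraph_adj_r_sr i j).2 ⟨t, ht, h⟩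
  have h0 : 0 ∈ deltaExponents n := by simp [deltaExponents]
  have hkS : 3 / Nat.gcd 3 n ∈ deltaExponents n := by simp [deltaExponents]
  have hnS : n ∈ deltaExponents n := by simp [deltaExponents]
  generalize 3 / Nat.gcd 3 n = k at *
  have hk0 : (k : ZMod (3 * n)) ≠ 0 := fun h =>
    hk.ne' (natCast_injOn_lt (m := 3 * n) (by omega) (by omega) (by simpa using h))
  have hn0 : (n : ZMod (3 * n)) ≠ 0 := fun h => by
    have := natCast_injOn_lt (m := 3 * n) (a := n) (b := 0) (by omega) (by omega) (by simpa using h)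
    omega
  have hkn0 : (k : ZMod (3 * n)) ≠ n := fun h =>
    hkn.ne (natCast_injOn_lt (m := 3 * n) (by omega) (by omega) h)
  have e₁ := adj h0 (i := 0) (j := 0) (by simp)
  have e₂ := adj hkS (i := k) (j := 0) (by simp)
  have e₃ := adj hnS (i := k) (j := k - n) (by ring)
  have e₄ := adj h0 (i := k - n) (j := k - n) (by simp)
  have e₅ := adj hkS (i := k - n) (j := -n) (by ring)
  have e₆ := adj hnS (i := 0) (j := -n) (by ring)
  refine ⟨.r 0, _, isCycle_of_nodup_six e₁ e₂.symm e₃ e₄.symm e₅ e₆.symm ?_, rfl⟩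
  simp only [List.nodup_cons, List.mem_cons, List.not_mem_nil, List.nodup_nil,
    DihedralGroup.r.injEq, DihedralGroup.sr.injEq, reduceCtorEq]
  grind

end DeltaGirth

theorem delta_girth_eq_six (n : ℕ) (hn : 3 ≤ n) : (deltaGraph n).girth = 6 := by
  have hle : 6 ≤ (deltaGraph n).egirth :=
    SimpleGraph.le_egirth.2 fun x w hw => by exact_mod_cast six_le_length_of_isCycle hn w hw
  obtain ⟨x, w, hw, hlen⟩ := exists_isCycle_length_six hn
  have hge : (deltaGraph n).egirth ≤ 6 := by
    simpa [hlen] using SimpleGraph.le_egirth.1 le_rfl x w hw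
  simp [SimpleGraph.girth, le_antisymm hge hle]
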